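/- arXiv:2309.06993 — 5 statements merged into one kernel-verified Lean document; each statement's English description precedes it below -/
import Mathlib

section
/- Let (T,d) be a proper metric space, let G be a group acting on T by isometries such that the action is properly discontinuous, let L be a finite-index subgroup of G, let φ : L → G be a group homomorphism, and let σ : T → T be a non-expanding map intertwined with φ. Suppose the translation distance τ_σ = inf_{x ∈ T} d(x, σ(x)) is not realized (there is no X ∈ T with d(X, σ(X)) = τ_σ). Then for every sequence (X_n) in T with d(X_n, σ(X_n)) → τ_σ, the image of (X_n) in the orbit space T/G (equipped with the quotient topology) is not contained in any compact subset of T/G. -/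
/-- A compact subset of an orbit space of a metric space is covered by the image of a closed ball. -/
theorem exists_closedBall_of_isCompact_orbitRel_quotient
    {T G : Type*} [MetricSpace T] [Group G] [MulAction G T] [ContinuousConstSMul G T]
    {C : Set (Quotient (MulAction.orbitRel G T))} (hC : IsCompact C) (x₀ : T) :
    ∃ R : ℝ, C ⊆ Quotient.mk (MulAction.orbitRel G T) '' Metric.closedBall x₀ R := by
  have hopen : IsOpenMap (Quotient.mk (MulAction.orbitRel G T)) :=
    isOpenMap_quotient_mk'_mul
  obtain ⟨n, hn⟩ := hC.elim_directed_cover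
    (fun n : ℕ => Quotient.mk (MulAction.orbitRel G T) '' Metric.ball x₀ n)
    (fun n => hopen _ Metric.isOpen_ball)
    (fun q _ => by
      obtain ⟨x, rfl⟩ := Quotient.exists_rep q
      obtain ⟨n, hn⟩ := exists_nat_gt (dist x x₀)
      exact Set.mem_iUnion.2 ⟨n, x, hn, rfl⟩)
    (directed_of_isDirected_le fun m n hmn =>
      Set.image_mono (Metric.ball_subset_ball (by exact_mod_cast hmn)))
  exact ⟨n, hn.trans (Set.image_mono Metric.ball_subset_closedBall)⟩

/-- If `L` has finite index in `G`, then the `G`-translates of a compact set are covered by the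
`L`-translates of a larger compact set. -/
theorem Subgroup.exists_isCompact_smul_mem
    {T G : Type*} [TopologicalSpace T] [Group G] [MulAction G T] [ContinuousConstSMul G T]
    (L : Subgroup G) [L.FiniteIndex] {K : Set T} (hK : IsCompact K) :
    ∃ K' : Set T, IsCompact K' ∧
      ∀ (g : G), ∀ y ∈ K, ∃ l : L, ∃ z ∈ K', g • y = (l : G) • z := by
  refine ⟨⋃ q : G ⧸ L, (fun x : T => q.out⁻¹ • x) '' K,
    isCompact_iUnion fun q => hK.image (continuous_const_smul _), fun g y hy => ?_⟩
  obtain ⟨l, hl⟩ := QuotientGroup.mk_out_eq_mul L g⁻¹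
  refine ⟨l, _, Set.mem_iUnion.2 ⟨(g⁻¹ : G), y, hy, rfl⟩, ?_⟩
  simp [hl, smul_smul]


/-- Proposition 4.1 (prop:metricmumford): if the translation distance of a
non-expanding map `σ` intertwined with a virtual endomorphism `φ` of a group `G`
acting properly discontinuously by isometries on a proper metric space `T` is
not realized, then any sequence whose displacement tends to the translation
distance leaves every compact subset of the orbit space `T/G`. -/
theorem stmt_0
    {T : Type*} [MetricSpace T] [ProperSpace T]
    {G : Type*} [Group G] [MulAction G T]
    (hiso : ∀ g : G, Isometry (fun x : T => g • x))
    (hpd : ∀ K K' : Set T, IsCompact K → IsCompact K' →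
      {g : G | ((fun x : T => g • x) '' K ∩ K').Nonempty}.Finite)
    (L : Subgroup G) (hL : L.FiniteIndex)
    (φ : L →* G)
    (σ : T → T)
    (hne : ∀ x y : T, dist (σ x) (σ y) ≤ dist x y)
    (hint : ∀ (g : L) (x : T), σ ((g : G) • x) = φ g • σ x)
    (τ : ℝ) (hτ : τ = ⨅ x : T, dist x (σ x))
    (hnr : ¬ ∃ X : T, dist X (σ X) = τ)
    (X : ℕ → T)
    (hX : Filter.Tendsto (fun n => dist (X n) (σ (X n))) Filter.atTop (nhds τ)) :
    ¬ ∃ C : Set (Quotient (MulAction.orbitRel G T)),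
        IsCompact C ∧ ∀ n, Quotient.mk (MulAction.orbitRel G T) (X n) ∈ C := by
  rintro ⟨C, hC, hXC⟩
  have : ContinuousConstSMul G T := ⟨fun g => (hiso g).continuous⟩
  have hσ : Continuous σ :=
    (LipschitzWith.of_dist_le_mul (K := 1) (by simpa using hne)).continuous
  obtain ⟨R, hR⟩ := exists_closedBall_of_isCompact_orbitRel_quotient hC (X 0)
  obtain ⟨K, hK, hGK⟩ := L.exists_isCompact_smul_mem (isCompact_closedBall (X 0) R)
  obtain ⟨M, hM⟩ := hX.bddAbove_range
  -- Displacements at points of an `L`-orbit are displacements of twisted maps at a single point.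
  have hdisp (l : L) (z : T) :
      dist ((l : G) • z) (σ ((l : G) • z)) = dist z (((l : G)⁻¹ * φ l) • σ z) := by
    rw [hint, ← (hiso (l : G)).dist_eq z]
    simp [smul_smul]
  set A : Set G := {g | ((fun x : T => g • x) '' (σ '' K) ∩ Metric.cthickening M K).Nonempty}
  have hA : A.Finite := hpd _ _ (hK.image hσ) hK.cthickening
  set D : Set ℝ := ⋃ g ∈ A ∩ Set.range (fun l : L => (l : G)⁻¹ * φ l),
    (fun z => dist z (g • σ z)) '' K
  have hD : IsCompact D := (hA.inter_of_left _).isCompact_biUnion fun g _ =>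
    hK.image (continuous_id.dist (hσ.const_smul g))
  have hXD (n : ℕ) : dist (X n) (σ (X n)) ∈ D := by
    obtain ⟨y, hy, hyX⟩ := hR (hXC n)
    obtain ⟨g, hg⟩ := MulAction.orbitRel_apply.1 (Quotient.exact hyX.symm)
    obtain ⟨l, z, hz, hlz⟩ := hGK g y hy
    have hXn : X n = (l : G) • z := hg.symm.trans hlz
    have hdn := hdisp l z
    rw [← hXn] at hdn
    refine Set.mem_biUnion (x := (l : G)⁻¹ * φ l) ⟨?_, l, rfl⟩ ⟨z, hz, hdn.symm⟩
    refine ⟨_, ⟨σ z, ⟨z, hz, rfl⟩, rfl⟩, Metric.mem_cthickening_of_dist_le _ z _ _ hz ?_⟩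
    rw [dist_comm, ← hdn]
    exact hM ⟨n, rfl⟩
  have hτD : τ ∈ D := hD.isClosed.mem_of_tendsto hX (Filter.Eventually.of_forall hXD)
  obtain ⟨g, ⟨-, l, rfl⟩, z, -, hz⟩ := Set.mem_iUnion₂.1 hτD
  exact hnr ⟨(l : G) • z, (hdisp l z).trans hz⟩
end

section
/- Let (T,d) be a proper metric space, let G be a group acting on T by isometries such that the action is properly discontinuous, let L be a finite-index subgroup of G, let φ : L → G be a group homomorphism, and let σ : T → T be a non-expanding map intertwined with φ. Suppose every orbit of σ is weakly contracting, i.e. d(σ(σ(x)), σ(σ(σ(x)))) < d(σ(x), σ(σ(x))) and d(σ(x), σ(σ(x))) < d(x, σ(x)) for every x ∈ T (equivalently, d(σ(x), σ²(x)) < d(x, σ(x)) for all x ∈ T). Then every orbit of σ leaves every compact subset of the orbit space T/G: for every X ∈ T and every compact subset C of T/G (with the quotient topology), the image of σⁿ(X) in T/G lies in C for only finitely many n. -/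
open Filter Topology

/-- An ultrafilter containing a union indexed by a finite set contains one of its members. -/
theorem Ultrafilter.exists_eventually_of_finite {α β : Type*} (U : Ultrafilter α) {S : Set β}
    (hS : S.Finite) {p : β → α → Prop} (h : ∀ᶠ a in U, ∃ b ∈ S, p b a) :
    ∃ b ∈ S, ∀ᶠ a in U, p b a := by
  have h' : (⋃ b ∈ S, {a | p b a}) ∈ U := by
    filter_upwards [h] with a ha
    simpa using ha
  exact (Ultrafilter.finite_biUnion_mem_iff hS).1 h'

/-- A sequence which an ultrafilter finer than `atTop` sees, up to elements of `L` fixed by `φ`,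
in a compact set cannot be a weakly contracting orbit. -/
theorem not_eventually_exists_smul_iterate_mem {T : Type*} [MetricSpace T]
    {G : Type*} [Group G] [MulAction G T]
    (hiso : ∀ g : G, Isometry (fun x : T => g • x))
    {L : Subgroup G} {φ : L →* G} {σ : T → T} (hσ : Continuous σ)
    (hint : ∀ (g : L) (x : T), σ ((g : G) • x) = φ g • σ x)
    (hwc : ∀ x : T, dist (σ x) (σ (σ x)) < dist x (σ x))
    (X : T) {K : Set T} (hK : IsCompact K) (U : Ultrafilter ℕ) (hU : (U : Filter ℕ) ≤ atTop) :
    ¬ ∀ᶠ n in (U : Filter ℕ), ∃ a : L, φ a = a ∧ (a : G) • σ^[n] X ∈ K := by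
  intro h
  obtain ⟨a, ha⟩ := h.choice
  set y : ℕ → T := fun n => (a n : G) • σ^[n] X
  obtain ⟨z, -, hz⟩ := hK.ultrafilter_le_nhds (U.map y) (by
    rw [le_principal_iff, Ultrafilter.coe_map, mem_map]
    filter_upwards [ha] with n hn using hn.2)
  have hy : Tendsto y U (𝓝 z) := hz
  have hanti : Antitone fun n => dist (σ^[n] X) (σ^[n + 1] X) := antitone_nat_of_succ_le fun n => by
    simpa only [Function.iterate_succ_apply'] using (hwc (σ^[n] X)).le
  obtain ⟨δ, hδ⟩ : ∃ δ, Tendsto (fun n => dist (σ^[n] X) (σ^[n + 1] X)) atTop (𝓝 δ) :=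
    ⟨_, tendsto_atTop_ciInf hanti ⟨0, by rintro _ ⟨n, rfl⟩; exact dist_nonneg⟩⟩
  have hσy : ∀ᶠ n in (U : Filter ℕ), σ (y n) = (a n : G) • σ^[n + 1] X := by
    filter_upwards [ha] with n hn
    rw [hint, hn.1, Function.iterate_succ_apply']
  have h₀ : dist z (σ z) = δ := by
    refine tendsto_nhds_unique (hy.dist ((hσ.tendsto z).comp hy)) ((hδ.mono_left hU).congr' ?_)
    filter_upwards [hσy] with n hn
    rw [Function.comp_apply, hn]
    exact ((hiso (a n)).dist_eq _ _).symm
  have h₁ : dist (σ z) (σ (σ z)) = δ := by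
    refine tendsto_nhds_unique
      (((hσ.tendsto z).comp hy).dist (((hσ.comp hσ).tendsto z).comp hy))
      ((((tendsto_add_atTop_iff_nat 1).2 hδ).mono_left hU).congr' ?_)
    filter_upwards [hσy, ha] with n hn hna
    simp only [Function.comp_apply]
    rw [hn, hint, hna.1, ← Function.iterate_succ_apply' σ (n + 1)]
    exact ((hiso (a n)).dist_eq _ _).symm
  exact (hwc z).ne (h₁.trans h₀.symm)


/-- Proposition 4.2 (prop:metricorbit): if every orbit of a non-expanding map
`σ` intertwined with a virtual endomorphism is weakly contracting, then every
orbit leaves every compact subset of the orbit space `T/G`. -/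
theorem stmt_1
    {T : Type*} [MetricSpace T] [ProperSpace T]
    {G : Type*} [Group G] [MulAction G T]
    (hiso : ∀ g : G, Isometry (fun x : T => g • x))
    (hpd : ∀ K K' : Set T, IsCompact K → IsCompact K' →
      {g : G | ((fun x : T => g • x) '' K ∩ K').Nonempty}.Finite)
    (L : Subgroup G) (hL : L.FiniteIndex)
    (φ : L →* G)
    (σ : T → T)
    (hne : ∀ x y : T, dist (σ x) (σ y) ≤ dist x y)
    (hint : ∀ (g : L) (x : T), σ ((g : G) • x) = φ g • σ x)
    (hwc : ∀ x : T, dist (σ x) (σ (σ x)) < dist x (σ x)) :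
    ∀ X : T, ∀ C : Set (Quotient (MulAction.orbitRel G T)), IsCompact C →
      {n : ℕ | Quotient.mk (MulAction.orbitRel G T) (σ^[n] X) ∈ C}.Finite := by
  intro X C hC
  by_contra hinf
  have : ContinuousConstSMul G T := ⟨fun g => (hiso g).continuous⟩
  have hσ : Continuous σ := (LipschitzWith.mk_one hne).continuous
  have : (atTop ⊓ 𝓟 {n : ℕ | Quotient.mk (MulAction.orbitRel G T) (σ^[n] X) ∈ C}).NeBot := by
    rw [← frequently_mem_iff_neBot]
    exact Nat.frequently_atTop_iff_infinite.2 hinf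
  set U := Ultrafilter.of (atTop ⊓ 𝓟 {n : ℕ | Quotient.mk (MulAction.orbitRel G T) (σ^[n] X) ∈ C})
  have hU := Ultrafilter.of_le
    (atTop ⊓ 𝓟 {n : ℕ | Quotient.mk (MulAction.orbitRel G T) (σ^[n] X) ∈ C})
  have hUtop : (U : Filter ℕ) ≤ atTop := hU.trans inf_le_left
  -- the orbit returns to the `G`-translates of a ball
  obtain ⟨c, -, hc⟩ := hC.ultrafilter_le_nhds
    (U.map fun n => Quotient.mk (MulAction.orbitRel G T) (σ^[n] X)) (by
      rw [le_principal_iff, Ultrafilter.coe_map, mem_map]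
      exact le_principal_iff.1 (hU.trans inf_le_right))
  obtain ⟨p, rfl⟩ := Quotient.exists_rep c
  have hball : ∀ᶠ n in (U : Filter ℕ), ∃ g : G, dist (g • σ^[n] X) p < 1 := by
    have hopen : IsOpenMap (Quotient.mk (MulAction.orbitRel G T)) :=
      isOpenMap_quotient_mk'_mul
    have hmem := hc (hopen.image_mem_nhds (Metric.ball_mem_nhds p one_pos))
    filter_upwards [hmem] with n hn
    obtain ⟨q, hq, hqn⟩ := hn
    obtain ⟨g, hg⟩ := MulAction.orbitRel_apply.1 (Quotient.exact hqn)
    exact ⟨g, by simpa [← hg] using hq⟩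
  -- by finiteness of the index, to the `L`-translates of a ball
  obtain ⟨q, -, hq⟩ := U.exists_eventually_of_finite (Set.finite_univ (α := G ⧸ L))
    (p := fun q n => ∃ m : L, dist ((m : G) • σ^[n] X) (q.out⁻¹ • p) < 1) (by
      filter_upwards [hball] with n ⟨g, hg⟩
      refine ⟨g, Set.mem_univ _, ⟨(g : G ⧸ L).out⁻¹ * g, ?_⟩, ?_⟩
      · exact QuotientGroup.eq.1 (QuotientGroup.out_eq' _)
      · rw [mul_smul]
        exact ((hiso _).dist_eq _ _).trans_lt hg)
  set r : T := q.out⁻¹ • p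
  have hstep (n : ℕ) : dist (σ^[n] X) (σ^[n + 1] X) ≤ dist X (σ X) := by
    induction n with
    | zero => exact le_rfl
    | succ n ih =>
      refine le_trans ?_ ih
      simpa only [Function.iterate_succ_apply'] using (hwc (σ^[n] X)).le
  -- by proper discontinuity, `m * (φ m)⁻¹` takes a constant value
  obtain ⟨s, -, hs⟩ := U.exists_eventually_of_finite
    (hpd (Metric.closedBall (σ r) 1) (Metric.closedBall r (dist X (σ X) + 1))
      (isCompact_closedBall _ _) (isCompact_closedBall _ _))
    (p := fun s n => ∃ m : L, (m : G) * (φ m)⁻¹ = s ∧ dist ((m : G) • σ^[n] X) r < 1) (by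
      filter_upwards [hq] with n ⟨m, hm⟩
      refine ⟨_, ⟨(m : G) • σ^[n + 1] X, ⟨σ ((m : G) • σ^[n] X), ?_, ?_⟩, ?_⟩, m, rfl, hm⟩
      · exact (hne _ _).trans hm.le
      · simp only [hint, Function.iterate_succ_apply', mul_smul, inv_smul_smul]
      · have h₁ : dist ((m : G) • σ^[n + 1] X) ((m : G) • σ^[n] X) ≤ dist X (σ X) := by
          rw [dist_comm]
          exact ((hiso m).dist_eq _ _).trans_le (hstep n)
        exact (dist_triangle _ _ _).trans (add_le_add h₁ hm.le))
  obtain ⟨-, l, hl, -⟩ := hs.exists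
  refine not_eventually_exists_smul_iterate_mem hiso hσ hint hwc X
    (isCompact_closedBall ((l : G)⁻¹ • r) 1) U hUtop ?_
  filter_upwards [hs] with n ⟨m, hm, hmn⟩
  refine ⟨l⁻¹ * m, ?_, ?_⟩
  · have hφ (k : L) (hk : (k : G) * (φ k)⁻¹ = s) : φ k = s⁻¹ * k := by
      rw [← hk]; group
    rw [map_mul, map_inv, hφ l hl, hφ m hm]
    push_cast
    group
  · rw [Metric.mem_closedBall, Subgroup.coe_mul, Subgroup.coe_inv, mul_smul]
    exact ((hiso _).dist_eq _ _).trans_le hmn.le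
end

section
/- Let (T,d) be a metric space and σ : T → T a non-expanding map whose translation distance τ_σ = inf_{x ∈ T} d(x, σ(x)) is realized at a point X, i.e. d(X, σ(X)) = τ_σ. Then for every point Y ∈ T lying metrically between X and σ(X), i.e. satisfying d(X,Y) + d(Y, σ(X)) = d(X, σ(X)), the following three equalities hold: (1) d(Y, σ(Y)) = τ_σ; (2) d(σ(X), σ(Y)) = d(X, Y); (3) d(Y, σ(X)) + d(σ(X), σ(Y)) = d(Y, σ(Y)). -/
/-- The chain of equalities from the proof of Proposition 4.3 (prop:metricray):
if a non-expanding map `σ` realizes its translation distance `τ` at `X`, then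
for every point `Y` metrically between `X` and `σ X` we have
`d(Y, σ Y) = τ`, `d(σ X, σ Y) = d(X, Y)`, and
`d(Y, σ X) + d(σ X, σ Y) = d(Y, σ Y)`. -/
theorem stmt_2
    {T : Type*} [MetricSpace T]
    (σ : T → T)
    (hne : ∀ x y : T, dist (σ x) (σ y) ≤ dist x y)
    (τ : ℝ) (hτ : τ = ⨅ x : T, dist x (σ x))
    (X : T) (hX : dist X (σ X) = τ)
    (Y : T) (hY : dist X Y + dist Y (σ X) = dist X (σ X)) :
    dist Y (σ Y) = τ ∧
    dist (σ X) (σ Y) = dist X Y ∧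
    dist Y (σ X) + dist (σ X) (σ Y) = dist Y (σ Y) := by
  have hle : τ ≤ dist Y (σ Y) := by
    rw [hτ]
    exact ciInf_le ⟨0, Set.forall_mem_range.2 fun _ => dist_nonneg⟩ Y
  have htri := dist_triangle Y (σ X) (σ Y)
  have hXY := hne X Y
  refine ⟨?_, ?_, ?_⟩ <;> linarith
end

section
/- Let (T,d) be a metric space in which geodesic extensions are unique, meaning: for all x, y, z, z' ∈ T with x ≠ y, if d(x,z) = d(x,y) + d(y,z), d(x,z') = d(x,y) + d(y,z'), and d(y,z) = d(y,z'), then z = z'. Let σ : T → T be a non-expanding map whose translation distance τ_σ = inf_{x ∈ T} d(x, σ(x)) is strictly positive and is realized at a point X, i.e. d(X, σ(X)) = τ_σ > 0. Suppose γ : [0,∞) → T is a unit-speed geodesic ray, i.e. d(γ(s), γ(t)) = |s − t| for all s, t ≥ 0, with γ(0) = X and γ(τ_σ) = σ(X). Then σ restricted to the ray is forward translation by τ_σ: σ(γ(t)) = γ(t + τ_σ) for all t ≥ 0. -/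
/-- Proposition 4.3 (prop:metricray): in a metric space with unique geodesic
extensions, a non-expanding map `σ` whose translation distance `τ > 0` is
realized at `X` acts by forward translation by `τ` along the unit-speed
geodesic ray from `X` through `σ X`. -/
theorem stmt_3
    {T : Type*} [MetricSpace T]
    (huniq : ∀ x y z z' : T, x ≠ y →
      dist x z = dist x y + dist y z →
      dist x z' = dist x y + dist y z' →
      dist y z = dist y z' → z = z')
    (σ : T → T)
    (hne : ∀ x y : T, dist (σ x) (σ y) ≤ dist x y)
    (τ : ℝ) (hτ : τ = ⨅ x : T, dist x (σ x)) (hpos : 0 < τ)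
    (X : T) (hX : dist X (σ X) = τ)
    (γ : ℝ → T)
    (hγ : ∀ s t : ℝ, 0 ≤ s → 0 ≤ t → dist (γ s) (γ t) = |s - t|)
    (hγ0 : γ 0 = X) (hγτ : γ τ = σ X) :
    ∀ t : ℝ, 0 ≤ t → σ (γ t) = γ (t + τ) := by
  have hle : ∀ x : T, τ ≤ dist x (σ x) := fun x => by
    rw [hτ]
    exact ciInf_le ⟨0, by rintro _ ⟨y, rfl⟩; exact dist_nonneg⟩ x
  have step : ∀ a t : ℝ, 0 ≤ a → a ≤ t → t < a + τ → σ (γ a) = γ (a + τ) →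
      σ (γ t) = γ (t + τ) := by
    intro a t ha hat hta h
    have h₁ : dist (γ t) (γ (a + τ)) = a + τ - t := by
      rw [hγ _ _ (by linarith) (by linarith), abs_of_nonpos (by linarith)]; ring
    have h₂ : dist (γ (a + τ)) (σ (γ t)) ≤ t - a := by
      rw [← h]
      refine (hne _ _).trans_eq ?_
      rw [hγ _ _ ha (by linarith), abs_of_nonpos (by linarith)]; ring
    have h₃ : dist (γ t) (γ (t + τ)) = τ := by
      rw [hγ _ _ (by linarith) (by linarith), abs_of_nonpos (by linarith)]; ring
    have h₄ : dist (γ (a + τ)) (γ (t + τ)) = t - a := by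
      rw [hγ _ _ (by linarith) (by linarith), abs_of_nonpos (by linarith)]; ring
    have h₅ := hle (γ t)
    have h₆ := dist_triangle (γ t) (γ (a + τ)) (σ (γ t))
    refine huniq (γ t) (γ (a + τ)) _ _ ?_ (by linarith) (by linarith) (by linarith)
    exact dist_pos.mp (by linarith)
  have hmul : ∀ n : ℕ, σ (γ (n * (τ / 2))) = γ (n * (τ / 2) + τ) := by
    intro n
    induction n with
    | zero => simp [hγ0, hγτ]
    | succ n ih =>
      refine step (n * (τ / 2)) _ (by positivity) ?_ ?_ ih <;> push_cast <;> linarith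
  intro t ht
  have hτ₂ : 0 < τ / 2 := by linarith
  have hlo := (le_div_iff₀ hτ₂).mp (Nat.floor_le (div_nonneg ht hτ₂.le))
  have hhi := (div_lt_iff₀ hτ₂).mp (Nat.lt_floor_add_one (t / (τ / 2)))
  exact step _ t (by positivity) hlo (by linarith) (hmul _)
end

section
/- Let (T,d) be a proper metric space, let G be a group acting on T by isometries such that the action is properly discontinuous, let L be a subgroup of G, let φ : L → G be a group homomorphism, and let σ : T → T be a non-expanding map intertwined with φ. Define F : T → ℝ by F(x) = inf_{g ∈ L} d(x, (g⁻¹·φ(g)) • σ(x)). Then: (a) for every x ∈ T the infimum is attained, i.e. there exists g ∈ L with F(x) = d(x, (g⁻¹·φ(g)) • σ(x)); (b) F(x) = inf_{g ∈ L} d(g • x, σ(g • x)) for every x ∈ T; (c) F is invariant under L, i.e. F(h • x) = F(x) for all h ∈ L and x ∈ T; and (d) F is continuous. -/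
/-- Along any family of elements of a properly discontinuous group acting on a proper space,
the distance from a point to the translates of another point attains its minimum. -/
theorem exists_forall_dist_smul_le
    {T : Type*} [MetricSpace T] [ProperSpace T] {G : Type*} [Group G] [MulAction G T]
    (hpd : ∀ K K' : Set T, IsCompact K → IsCompact K' →
      {g : G | ((fun x : T => g • x) '' K ∩ K').Nonempty}.Finite)
    {ι : Type*} [Nonempty ι] (w : ι → G) (x y : T) :
    ∃ i, ∀ j, dist x (w i • y) ≤ dist x (w j • y) := by
  obtain ⟨k⟩ := ‹Nonempty ι›
  have hfin : {g ∈ Set.range w | dist x (g • y) ≤ dist x (w k • y)}.Finite := by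
    refine (hpd {y} (Metric.closedBall x (dist x (w k • y))) isCompact_singleton
      (isCompact_closedBall _ _)).subset ?_
    rintro g ⟨-, hg⟩
    exact ⟨g • y, ⟨y, rfl, rfl⟩, by rwa [Metric.mem_closedBall, dist_comm]⟩
  obtain ⟨_, ⟨⟨i, rfl⟩, hi⟩, hmin⟩ := Set.exists_min_image _ (fun g => dist x (g • y)) hfin
    ⟨w k, ⟨k, rfl⟩, le_rfl⟩
  refine ⟨i, fun j => ?_⟩
  by_cases hj : dist x (w j • y) ≤ dist x (w k • y)
  · exact hmin _ ⟨⟨j, rfl⟩, hj⟩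
  · exact hi.trans (not_le.mp hj).le

/-- The function `F` from the proof of Proposition 4.1 (prop:metricmumford):
`F x = inf_{g ∈ L} d(x, (g⁻¹ φ(g)) • σ x)`. The infimum is attained, `F` also
equals `inf_{g ∈ L} d(g • x, σ (g • x))`, `F` is `L`-invariant (hence descends
to `T/L`), and `F` is continuous. -/
theorem stmt_6
    {T : Type*} [MetricSpace T] [ProperSpace T]
    {G : Type*} [Group G] [MulAction G T]
    (hiso : ∀ g : G, Isometry (fun x : T => g • x))
    (hpd : ∀ K K' : Set T, IsCompact K → IsCompact K' →
      {g : G | ((fun x : T => g • x) '' K ∩ K').Nonempty}.Finite)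
    (L : Subgroup G) (φ : L →* G)
    (σ : T → T)
    (hne : ∀ x y : T, dist (σ x) (σ y) ≤ dist x y)
    (hint : ∀ (g : L) (x : T), σ ((g : G) • x) = φ g • σ x)
    (F : T → ℝ)
    (hF : ∀ x : T, F x = ⨅ g : L, dist x (((g : G)⁻¹ * φ g) • σ x)) :
    (∀ x : T, ∃ g : L, F x = dist x (((g : G)⁻¹ * φ g) • σ x)) ∧
    (∀ x : T, F x = ⨅ g : L, dist ((g : G) • x) (σ ((g : G) • x))) ∧
    (∀ (h : L) (x : T), F ((h : G) • x) = F x) ∧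
    Continuous F := by
  have bdd (x : T) : BddBelow (Set.range fun g : L => dist x (((g : G)⁻¹ * φ g) • σ x)) :=
    ⟨0, by rintro _ ⟨g, rfl⟩; exact dist_nonneg⟩
  have attained (x : T) : ∃ g : L, F x = dist x (((g : G)⁻¹ * φ g) • σ x) := by
    obtain ⟨g, hg⟩ := exists_forall_dist_smul_le hpd (fun g : L => (g : G)⁻¹ * φ g) x (σ x)
    exact ⟨g, (hF x).trans (le_antisymm (ciInf_le (bdd x) g) (le_ciInf hg))⟩
  have eq_displacement (x : T) : F x = ⨅ g : L, dist ((g : G) • x) (σ ((g : G) • x)) := by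
    rw [hF]
    refine iInf_congr fun g => ?_
    rw [hint, ← (hiso (g : G)).dist_eq x]
    simp only [mul_smul, smul_inv_smul]
  refine ⟨attained, eq_displacement, fun h x => ?_, ?_⟩
  · rw [eq_displacement, eq_displacement]
    refine (Equiv.mulRight h).iInf_congr fun g => ?_
    simp [mul_smul]
  · refine (LipschitzWith.of_le_add_mul 2 fun x y => ?_).continuous
    obtain ⟨g, hg⟩ := attained y
    have hle : F x ≤ dist x (((g : G)⁻¹ * φ g) • σ x) := (hF x).trans_le (ciInf_le (bdd x) g)
    have htri := dist_triangle4 x y (((g : G)⁻¹ * φ g) • σ y) (((g : G)⁻¹ * φ g) • σ x)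
    have hσ : dist (((g : G)⁻¹ * φ g) • σ y) (((g : G)⁻¹ * φ g) • σ x) ≤ dist x y :=
      ((hiso _).dist_eq _ _).trans_le ((hne y x).trans_eq (dist_comm y x))
    push_cast
    linarith
end
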